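/- arXiv:math/0501430 — 2 statements merged into one kernel-verified Lean document; each statement's English description precedes it below -/
import Mathlib

section
/- Let n > 0 and let L be a bounded n-modular lattice. Then the map ε : x ↦ (x, 0, 0) is a lattice embedding of L into the lattice M₃[L], and M₃[L] is a congruence-preserving extension of ε(L): for every congruence Θ of L there is exactly one congruence Φ of M₃[L] such that ε(x) Φ ε(y) if and only if x Θ y, for all x, y ∈ L; this unique extension is the restriction of the congruence Θ³ of L³ to M₃[L]. -/
/-- A triple `(x, y, z)` in a lattice is *balanced* if `x ⊓ y = x ⊓ z = y ⊓ z`. -/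
def IsBalanced {α : Type*} [Lattice α] (t : α × α × α) : Prop :=
  t.1 ⊓ t.2.1 = t.1 ⊓ t.2.2 ∧ t.1 ⊓ t.2.2 = t.2.1 ⊓ t.2.2

/-- One step of the balancing sequence; `adjT^[n] (x,y,z) = (pₙ, qₙ, rₙ)` at `(x,y,z)`. -/
def adjT {α : Type*} [Lattice α] (t : α × α × α) : α × α × α :=
  (t.1 ⊔ t.2.1 ⊓ t.2.2, t.2.1 ⊔ t.1 ⊓ t.2.2, t.2.2 ⊔ t.1 ⊓ t.2.1)

/-- A lattice is `n`-modular (satisfies the identity `γₙ : pₙ = pₙ₊₁`). -/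
def NModular (α : Type*) [Lattice α] (n : ℕ) : Prop :=
  ∀ t : α × α × α, (adjT^[n] t).1 = (adjT^[n + 1] t).1

/-- A congruence of a lattice: an equivalence relation with the substitution properties. -/
def IsLatCon {α : Type*} [Lattice α] (Θ : α → α → Prop) : Prop :=
  Equivalence Θ ∧ (∀ a b c, Θ a b → Θ (a ⊔ c) (b ⊔ c)) ∧
    (∀ a b c, Θ a b → Θ (a ⊓ c) (b ⊓ c))

/-- A congruence of a poset-which-is-a-lattice, stated order-theoretically: an equivalence
relation with the substitution property for binary joins (least upper bounds) and binary
meets (greatest lower bounds). -/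
def IsConP {β : Type*} [PartialOrder β] (Θ : β → β → Prop) : Prop :=
  Equivalence Θ ∧
  (∀ a b c s t, Θ a b → IsLUB {a, c} s → IsLUB {b, c} t → Θ s t) ∧
  (∀ a b c s t, Θ a b → IsGLB {a, c} s → IsGLB {b, c} t → Θ s t)

/-- The map `ε : x ↦ (x, 0, 0)` from `L` into `M₃[L]`. -/
def epsM3 {α : Type*} [Lattice α] [OrderBot α] (x : α) :
    {t : α × α × α // IsBalanced t} :=
  ⟨(x, ⊥, ⊥), by simp [IsBalanced]⟩

section BalancedTriples

variable {α : Type*} [Lattice α]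

theorem IsBalanced.inf {a b : α × α × α} (ha : IsBalanced a) (hb : IsBalanced b) :
    IsBalanced (a ⊓ b) := by
  obtain ⟨h₁, h₂⟩ := ha
  obtain ⟨h₃, h₄⟩ := hb
  simp only [IsBalanced, Prod.fst_inf, Prod.snd_inf]
  constructor
  · rw [inf_inf_inf_comm, h₁, h₃, inf_inf_inf_comm]
  · rw [inf_inf_inf_comm, h₂, h₄, inf_inf_inf_comm]

theorem isBalanced_iff_adjT_eq {t : α × α × α} : IsBalanced t ↔ adjT t = t := by
  obtain ⟨x, y, z⟩ := t
  simp only [IsBalanced, adjT, Prod.mk.injEq, sup_eq_left]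
  constructor
  · rintro ⟨h₁, h₂⟩
    exact ⟨h₂ ▸ inf_le_left, h₁ ▸ inf_le_right, h₁.trans h₂ ▸ inf_le_right⟩
  · rintro ⟨h₁, h₂, h₃⟩
    exact ⟨le_antisymm (le_inf inf_le_left h₃) (le_inf inf_le_left h₂),
      le_antisymm (le_inf h₂ inf_le_right) (le_inf h₁ inf_le_right)⟩

theorem le_adjT (t : α × α × α) : t ≤ adjT t :=
  ⟨le_sup_left, le_sup_left, le_sup_left⟩

theorem adjT_monotone : Monotone (adjT (α := α)) := fun _ _ h =>
  ⟨sup_le_sup h.1 (inf_le_inf h.2.1 h.2.2), sup_le_sup h.2.1 (inf_le_inf h.1 h.2.2),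
    sup_le_sup h.2.2 (inf_le_inf h.1 h.2.1)⟩

theorem adjT_iterate_le {t u : α × α × α} (hu : IsBalanced u) (h : t ≤ u) (n : ℕ) :
    adjT^[n] t ≤ u := by
  simpa [Function.iterate_fixed (isBalanced_iff_adjT_eq.1 hu) n] using adjT_monotone.iterate n h

theorem adjT_commute_rotate :
    Function.Commute (adjT (α := α)) (fun t => (t.2.1, t.2.2, t.1)) := fun t => by
  simp [adjT, inf_comm]

theorem NModular.isBalanced_adjT_iterate {n : ℕ} (h : NModular α n) (t : α × α × α) :
    IsBalanced (adjT^[n] t) := by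
  have comm (k : ℕ) := (adjT_commute_rotate (α := α)).iterate_left k
  rw [isBalanced_iff_adjT_eq, ← Function.iterate_succ_apply' adjT n t]
  refine Prod.ext (h t).symm (Prod.ext ?_ ?_)
  · have key := h (t.2.1, t.2.2, t.1)
    rw [comm n t, comm (n + 1) t] at key
    exact key.symm
  · have key := h (t.2.2, t.1, t.2.1)
    have rot : (t.2.2, t.1, t.2.1) = (fun s : α × α × α => (s.2.1, s.2.2, s.1))
      (t.2.1, t.2.2, t.1) := rfl
    rw [rot, comm n _, comm (n + 1) _, comm n t, comm (n + 1) t] at key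
    exact key.symm

theorem isGLB_balanced_inf (a b : {t : α × α × α // IsBalanced t}) :
    IsGLB {a, b} (⟨a.1 ⊓ b.1, a.2.inf b.2⟩ : {t : α × α × α // IsBalanced t}) := by
  refine ⟨?_, fun u hu => ?_⟩
  · rintro u (rfl | rfl)
    exacts [inf_le_left (a := (_ : α × α × α)), inf_le_right (a := (_ : α × α × α))]
  · have ha : u ≤ a := hu (Or.inl rfl)
    have hb : u ≤ b := hu (Or.inr rfl)
    exact le_inf (show u.1 ≤ a.1 from ha) hb

theorem NModular.isLUB_balanced_sup {n : ℕ} (h : NModular α n)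
    (a b : {t : α × α × α // IsBalanced t}) :
    IsLUB {a, b} (⟨adjT^[n] (a.1 ⊔ b.1), h.isBalanced_adjT_iterate _⟩ :
      {t : α × α × α // IsBalanced t}) := by
  have le := Function.id_le_iterate_of_id_le (le_adjT (α := α)) n (a.1 ⊔ b.1)
  refine ⟨?_, fun u hu => ?_⟩
  · rintro u (rfl | rfl)
    exacts [le_sup_left.trans le, le_sup_right.trans le]
  · exact adjT_iterate_le u.2 (sup_le (hu (Or.inl rfl)) (hu (Or.inr rfl))) n

end BalancedTriples

section Congruences

namespace IsLatCon

variable {α : Type*} [Lattice α] {Θ : α → α → Prop}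

theorem sup (hΘ : IsLatCon Θ) {a b c d : α} (h₁ : Θ a b) (h₂ : Θ c d) : Θ (a ⊔ c) (b ⊔ d) := by
  refine hΘ.1.trans (hΘ.2.1 _ _ c h₁) ?_
  rw [sup_comm b, sup_comm b]
  exact hΘ.2.1 _ _ b h₂

theorem inf (hΘ : IsLatCon Θ) {a b c d : α} (h₁ : Θ a b) (h₂ : Θ c d) : Θ (a ⊓ c) (b ⊓ d) := by
  refine hΘ.1.trans (hΘ.2.2 _ _ c h₁) ?_
  rw [inf_comm b, inf_comm b]
  exact hΘ.2.2 _ _ b h₂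

theorem adjT_iterate (hΘ : IsLatCon Θ) (n : ℕ) {s t : α × α × α}
    (h : Θ s.1 t.1 ∧ Θ s.2.1 t.2.1 ∧ Θ s.2.2 t.2.2) :
    Θ (adjT^[n] s).1 (adjT^[n] t).1 ∧ Θ (adjT^[n] s).2.1 (adjT^[n] t).2.1 ∧
      Θ (adjT^[n] s).2.2 (adjT^[n] t).2.2 := by
  induction n with
  | zero => exact h
  | succ n ih =>
    obtain ⟨h₁, h₂, h₃⟩ := ih
    simp only [Function.iterate_succ_apply']
    exact ⟨hΘ.sup h₁ (hΘ.inf h₂ h₃), hΘ.sup h₂ (hΘ.inf h₁ h₃), hΘ.sup h₃ (hΘ.inf h₁ h₂)⟩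

/-- In an `n`-modular lattice `Θ³` restricts to a congruence of the balanced triples. -/
theorem isConP_balanced (hΘ : IsLatCon Θ) {n : ℕ} (h : NModular α n) :
    IsConP (fun s t : {t : α × α × α // IsBalanced t} =>
      Θ s.val.1 t.val.1 ∧ Θ s.val.2.1 t.val.2.1 ∧ Θ s.val.2.2 t.val.2.2) := by
  have refl := hΘ.1.refl
  refine ⟨⟨fun s => ⟨refl _, refl _, refl _⟩,
    fun h => ⟨hΘ.1.symm h.1, hΘ.1.symm h.2.1, hΘ.1.symm h.2.2⟩,
    fun h k => ⟨hΘ.1.trans h.1 k.1, hΘ.1.trans h.2.1 k.2.1, hΘ.1.trans h.2.2 k.2.2⟩⟩, ?_, ?_⟩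
  · intro a b c s t hab hs ht
    rw [hs.unique (h.isLUB_balanced_sup a c), ht.unique (h.isLUB_balanced_sup b c)]
    exact hΘ.adjT_iterate n
      ⟨hΘ.sup hab.1 (refl _), hΘ.sup hab.2.1 (refl _), hΘ.sup hab.2.2 (refl _)⟩
  · intro a b c s t hab hs ht
    rw [hs.unique (isGLB_balanced_inf a c), ht.unique (isGLB_balanced_inf b c)]
    exact ⟨hΘ.inf hab.1 (refl _), hΘ.inf hab.2.1 (refl _), hΘ.inf hab.2.2 (refl _)⟩

end IsLatCon

theorem IsConP.of_isLUB {β : Type*} [PartialOrder β] {Φ : β → β → Prop} (hΦ : IsConP Φ)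
    {a b c d s t u : β} (hab : Φ a b) (hcd : Φ c d) (hs : IsLUB {a, c} s) (hu : IsLUB {b, c} u)
    (ht : IsLUB {b, d} t) : Φ s t := by
  refine hΦ.1.trans (hΦ.2.1 _ _ _ _ _ hab hs hu) ?_
  rw [Set.pair_comm] at hu ht
  exact hΦ.2.1 _ _ _ _ _ hcd hu ht

end Congruences

section Embeddings

variable {α : Type*} [Lattice α]

section OrderBot

variable [OrderBot α]

/-- The embedding `y ↦ (0, y, 0)` into the balanced triples. -/
def balancedSnd (y : α) : {t : α × α × α // IsBalanced t} :=
  ⟨(⊥, y, ⊥), by simp [IsBalanced]⟩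

/-- The embedding `z ↦ (0, 0, z)` into the balanced triples. -/
def balancedTrd (z : α) : {t : α × α × α // IsBalanced t} :=
  ⟨(⊥, ⊥, z), by simp [IsBalanced]⟩

theorem isLUB_epsM3_sup (x y : α) : IsLUB {epsM3 x, epsM3 y} (epsM3 (x ⊔ y)) := by
  refine ⟨?_, fun u hu => ?_⟩
  · rintro u (rfl | rfl)
    exacts [⟨le_sup_left, le_rfl, le_rfl⟩, ⟨le_sup_right, le_rfl, le_rfl⟩]
  · exact ⟨sup_le (hu (Or.inl rfl)).1 (hu (Or.inr rfl)).1, bot_le, bot_le⟩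

theorem isGLB_epsM3_inf (x y : α) : IsGLB {epsM3 x, epsM3 y} (epsM3 (x ⊓ y)) := by
  convert isGLB_balanced_inf (epsM3 x) (epsM3 y) using 1
  simp [epsM3]

theorem isLUB_epsM3_balancedSnd (x y : α) :
    IsLUB {epsM3 x, balancedSnd y}
      (⟨(x, y, x ⊓ y), by simp [IsBalanced]⟩ :
        {t : α × α × α // IsBalanced t}) := by
  refine ⟨?_, fun u hu => ?_⟩
  · rintro u (rfl | rfl)
    exacts [⟨le_rfl, bot_le, bot_le⟩, ⟨bot_le, le_rfl, bot_le⟩]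
  · have hx : x ≤ u.1.1 := (hu (Or.inl rfl)).1
    have hy : y ≤ u.1.2.1 := (hu (Or.inr rfl)).2.1
    exact ⟨hx, hy, (inf_le_inf hx hy).trans (u.2.1 ▸ inf_le_right)⟩

theorem isLUB_balancedTrd (s : {t : α × α × α // IsBalanced t}) :
    IsLUB {(⟨(s.1.1, s.1.2.1, s.1.1 ⊓ s.1.2.1), by simp [IsBalanced]⟩ :
        {t : α × α × α // IsBalanced t}), balancedTrd s.1.2.2} s := by
  refine ⟨?_, fun u hu => ?_⟩
  · rintro u (rfl | rfl)
    exacts [⟨le_rfl, le_rfl, s.2.1.le.trans inf_le_right⟩, ⟨bot_le, bot_le, le_rfl⟩]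
  · exact ⟨(hu (Or.inl rfl)).1, (hu (Or.inl rfl)).2.1, (hu (Or.inr rfl)).2.2⟩

/-- A congruence relating the components of two balanced triples along the three coordinate
embeddings relates the triples. -/
theorem IsConP.of_components {Φ : {t : α × α × α // IsBalanced t} →
    {t : α × α × α // IsBalanced t} → Prop} (hΦ : IsConP Φ)
    {s t : {t : α × α × α // IsBalanced t}} (h₁ : Φ (epsM3 s.1.1) (epsM3 t.1.1))
    (h₂ : Φ (balancedSnd s.1.2.1) (balancedSnd t.1.2.1))
    (h₃ : Φ (balancedTrd s.1.2.2) (balancedTrd t.1.2.2))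
    (hsup : ∀ a b : {t : α × α × α // IsBalanced t}, ∃ u, IsLUB {a, b} u) : Φ s t := by
  have h₁₂ := hΦ.of_isLUB h₁ h₂ (isLUB_epsM3_balancedSnd _ _) (isLUB_epsM3_balancedSnd _ _)
    (isLUB_epsM3_balancedSnd _ _)
  obtain ⟨u, hu⟩ := hsup ⟨(t.1.1, t.1.2.1, t.1.1 ⊓ t.1.2.1), by simp [IsBalanced]⟩
    (balancedTrd s.1.2.2)
  exact hΦ.of_isLUB h₁₂ h₃ (isLUB_balancedTrd s) hu (isLUB_balancedTrd t)

end OrderBot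

variable [BoundedOrder α]

theorem isGLB_epsM3_top (s : {t : α × α × α // IsBalanced t}) :
    IsGLB {s, epsM3 ⊤} (epsM3 s.1.1) := by
  convert isGLB_balanced_inf s (epsM3 ⊤) using 1
  exact Subtype.ext (by simp [epsM3, Prod.ext_iff, Prod.le_def])

theorem isGLB_balancedSnd_top (s : {t : α × α × α // IsBalanced t}) :
    IsGLB {s, balancedSnd ⊤} (balancedSnd s.1.2.1) := by
  convert isGLB_balanced_inf s (balancedSnd ⊤) using 1
  exact Subtype.ext (by simp [balancedSnd, Prod.ext_iff])

theorem isGLB_balancedTrd_top (s : {t : α × α × α // IsBalanced t}) :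
    IsGLB {s, balancedTrd ⊤} (balancedTrd s.1.2.2) := by
  convert isGLB_balanced_inf s (balancedTrd ⊤) using 1
  exact Subtype.ext (by simp [balancedTrd, Prod.ext_iff])

theorem isLUB_epsM3_balancedTrd_top (x : α) :
    IsLUB {epsM3 x, balancedTrd ⊤}
      (⟨(x, x, ⊤), by simp [IsBalanced]⟩ : {t : α × α × α // IsBalanced t}) := by
  refine ⟨?_, fun u hu => ?_⟩
  · rintro u (rfl | rfl)
    exacts [⟨le_rfl, bot_le, bot_le⟩, ⟨bot_le, bot_le, le_rfl⟩]
  · have hx : x ≤ u.1.1 := (hu (Or.inl rfl)).1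
    have hz : ⊤ ≤ u.1.2.2 := (hu (Or.inr rfl)).2.2
    exact ⟨hx, (le_inf hx (le_top.trans hz)).trans (u.2.2 ▸ inf_le_left), hz⟩

theorem isLUB_balancedSnd_balancedTrd_top (x : α) :
    IsLUB {balancedSnd x, balancedTrd ⊤}
      (⟨(x, x, ⊤), by simp [IsBalanced]⟩ : {t : α × α × α // IsBalanced t}) := by
  refine ⟨?_, fun u hu => ?_⟩
  · rintro u (rfl | rfl)
    exacts [⟨bot_le, le_rfl, bot_le⟩, ⟨bot_le, bot_le, le_rfl⟩]
  · have hx : x ≤ u.1.2.1 := (hu (Or.inl rfl)).2.1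
    have hz : ⊤ ≤ u.1.2.2 := (hu (Or.inr rfl)).2.2
    exact ⟨(le_inf hx (le_top.trans hz)).trans (u.2.2 ▸ inf_le_left), hx, hz⟩

theorem isLUB_epsM3_balancedSnd_top (x : α) :
    IsLUB {epsM3 x, balancedSnd ⊤}
      (⟨(x, ⊤, x), by simp [IsBalanced]⟩ : {t : α × α × α // IsBalanced t}) := by
  convert isLUB_epsM3_balancedSnd x ⊤ using 1
  simp

theorem isLUB_balancedTrd_balancedSnd_top (x : α) :
    IsLUB {balancedTrd x, balancedSnd ⊤}
      (⟨(x, ⊤, x), by simp [IsBalanced]⟩ : {t : α × α × α // IsBalanced t}) := by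
  refine ⟨?_, fun u hu => ?_⟩
  · rintro u (rfl | rfl)
    exacts [⟨bot_le, bot_le, le_rfl⟩, ⟨bot_le, le_rfl, bot_le⟩]
  · have hx : x ≤ u.1.2.2 := (hu (Or.inl rfl)).2.2
    have hy : ⊤ ≤ u.1.2.1 := (hu (Or.inr rfl)).2.1
    exact ⟨(le_inf (le_top.trans hy) hx).trans (u.2.2 ▸ inf_le_left), hy, hx⟩

namespace IsConP

variable {Φ : {t : α × α × α // IsBalanced t} → {t : α × α × α // IsBalanced t} → Prop}

theorem balancedSnd_iff (hΦ : IsConP Φ) {x y : α} :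
    Φ (balancedSnd x) (balancedSnd y) ↔ Φ (epsM3 x) (epsM3 y) := by
  constructor <;> intro hxy
  · exact hΦ.2.2 _ _ _ _ _ (hΦ.2.1 _ _ _ _ _ hxy (isLUB_balancedSnd_balancedTrd_top x)
      (isLUB_balancedSnd_balancedTrd_top y)) (isGLB_epsM3_top _) (isGLB_epsM3_top _)
  · exact hΦ.2.2 _ _ _ _ _ (hΦ.2.1 _ _ _ _ _ hxy (isLUB_epsM3_balancedTrd_top x)
      (isLUB_epsM3_balancedTrd_top y)) (isGLB_balancedSnd_top _) (isGLB_balancedSnd_top _)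

theorem balancedTrd_iff (hΦ : IsConP Φ) {x y : α} :
    Φ (balancedTrd x) (balancedTrd y) ↔ Φ (epsM3 x) (epsM3 y) := by
  constructor <;> intro hxy
  · exact hΦ.2.2 _ _ _ _ _ (hΦ.2.1 _ _ _ _ _ hxy (isLUB_balancedTrd_balancedSnd_top x)
      (isLUB_balancedTrd_balancedSnd_top y)) (isGLB_epsM3_top _) (isGLB_epsM3_top _)
  · exact hΦ.2.2 _ _ _ _ _ (hΦ.2.1 _ _ _ _ _ hxy (isLUB_epsM3_balancedSnd_top x)
      (isLUB_epsM3_balancedSnd_top y)) (isGLB_balancedTrd_top _) (isGLB_balancedTrd_top _)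

/-- A congruence of the balanced triples is determined componentwise by its restriction to the
image of `epsM3`. -/
theorem iff_epsM3 (hΦ : IsConP Φ)
    (hsup : ∀ a b : {t : α × α × α // IsBalanced t}, ∃ u, IsLUB {a, b} u)
    (s t : {t : α × α × α // IsBalanced t}) :
    Φ s t ↔ Φ (epsM3 s.1.1) (epsM3 t.1.1) ∧ Φ (epsM3 s.1.2.1) (epsM3 t.1.2.1) ∧
      Φ (epsM3 s.1.2.2) (epsM3 t.1.2.2) := by
  constructor
  · intro hst
    exact ⟨hΦ.2.2 _ _ _ _ _ hst (isGLB_epsM3_top s) (isGLB_epsM3_top t),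
      hΦ.balancedSnd_iff.1
        (hΦ.2.2 _ _ _ _ _ hst (isGLB_balancedSnd_top s) (isGLB_balancedSnd_top t)),
      hΦ.balancedTrd_iff.1
        (hΦ.2.2 _ _ _ _ _ hst (isGLB_balancedTrd_top s) (isGLB_balancedTrd_top t))⟩
  · rintro ⟨h₁, h₂, h₃⟩
    exact hΦ.of_components h₁ (hΦ.balancedSnd_iff.2 h₂) (hΦ.balancedTrd_iff.2 h₃) hsup

end IsConP

end Embeddings

/-- Let `n > 0` and let `L` be a bounded `n`-modular lattice.  Then `M₃[L]` is a lattice,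
`ε : x ↦ (x, 0, 0)` is a lattice embedding of `L` into `M₃[L]`, and `M₃[L]` is a
congruence-preserving extension of `ε(L)`: for every congruence `Θ` of `L`, the restriction
of `Θ³` to `M₃[L]` is the unique congruence `Φ` of `M₃[L]` with `Φ (ε x) (ε y) ↔ Θ x y`. -/
theorem stmt6 {α : Type*} [Lattice α] [BoundedOrder α] (n : ℕ) (hn : 0 < n)
    (h : NModular α n) (Θ : α → α → Prop) (hΘ : IsLatCon Θ) :
    (∀ a b : {t : α × α × α // IsBalanced t}, ∃ s, IsLUB {a, b} s) ∧
    Function.Injective (epsM3 (α := α)) ∧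
    (∀ x y : α, IsLUB {epsM3 x, epsM3 y} (epsM3 (x ⊔ y)) ∧
       IsGLB {epsM3 x, epsM3 y} (epsM3 (x ⊓ y))) ∧
    IsConP (fun s t : {t : α × α × α // IsBalanced t} =>
      Θ s.val.1 t.val.1 ∧ Θ s.val.2.1 t.val.2.1 ∧ Θ s.val.2.2 t.val.2.2) ∧
    (∀ x y : α,
      ((fun s t : {t : α × α × α // IsBalanced t} =>
          Θ s.val.1 t.val.1 ∧ Θ s.val.2.1 t.val.2.1 ∧ Θ s.val.2.2 t.val.2.2)
        (epsM3 x) (epsM3 y)) ↔ Θ x y) ∧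
    (∀ Φ : {t : α × α × α // IsBalanced t} → {t : α × α × α // IsBalanced t} → Prop,
      IsConP Φ → (∀ x y : α, Φ (epsM3 x) (epsM3 y) ↔ Θ x y) →
      Φ = fun s t => Θ s.val.1 t.val.1 ∧ Θ s.val.2.1 t.val.2.1 ∧ Θ s.val.2.2 t.val.2.2) := by
  have hsup (a b : {t : α × α × α // IsBalanced t}) : ∃ s, IsLUB {a, b} s :=
    ⟨_, h.isLUB_balanced_sup a b⟩
  refine ⟨hsup, fun x y hxy => congrArg (fun s => s.1.1) hxy,
    fun x y => ⟨isLUB_epsM3_sup x y, isGLB_epsM3_inf x y⟩, hΘ.isConP_balanced h,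
    fun x y => ⟨fun hxy => hxy.1, fun hxy => ⟨hxy, hΘ.1.refl _, hΘ.1.refl _⟩⟩, ?_⟩
  intro Φ hΦ hext
  ext s t
  rw [hΦ.iff_epsM3 hsup, hext, hext, hext]
end

section
/- There exists a bounded lattice L (with least element) such that the tensor product M₃ ⊗ L is not a lattice; thus the tensor product of two lattices with zero need not be a lattice (negative solution to Quackenbush's problem). -/
section TensorDefs

variable {α β : Type*} [Lattice α] [OrderBot α] [Lattice β] [OrderBot β]

/-- `∇ = (A × {0}) ∪ ({0} × B)`. -/
def nablaSet (α β : Type*) [Lattice α] [OrderBot α] [Lattice β] [OrderBot β] :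
    Set (α × β) :=
  {p | p.1 = ⊥ ∨ p.2 = ⊥}

/-- A *bi-ideal* of `A × B`: a down-set containing `∇` and closed under joins in each
coordinate separately. -/
def IsBiIdeal (I : Set (α × β)) : Prop :=
  IsLowerSet I ∧ nablaSet α β ⊆ I ∧
  (∀ a₀ a₁ b, (a₀, b) ∈ I → (a₁, b) ∈ I → (a₀ ⊔ a₁, b) ∈ I) ∧
  (∀ a b₀ b₁, (a, b₀) ∈ I → (a, b₁) ∈ I → (a, b₀ ⊔ b₁) ∈ I)

/-- Membership in the tensor product `A ⊗ B`: the bi-ideals that are finite joins of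
pure tensors `a ⊗ b`, i.e. the smallest bi-ideal containing some finite subset of `A × B`. -/
def InTensor (I : Set (α × β)) : Prop :=
  ∃ s : Finset (α × β), I = ⋂₀ {J : Set (α × β) | IsBiIdeal J ∧ ↑s ⊆ J}

end TensorDefs

/-- The tensor product `A ⊗ B`, as a partially ordered set (ordered by inclusion). -/
abbrev TensorProd (α β : Type*) [Lattice α] [OrderBot α] [Lattice β] [OrderBot β] :=
  {I : Set (α × β) // InTensor I}
/-- `M` is the lattice `M₃`: it consists of the five distinct elements `⊥, a, b, c, ⊤`,
where `a`, `b`, `c` are three atoms with pairwise meets `⊥` and pairwise joins `⊤`. -/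
def IsM3 (M : Type*) [Lattice M] [BoundedOrder M] (a b c : M) : Prop :=
  (∀ x : M, x = ⊥ ∨ x = a ∨ x = b ∨ x = c ∨ x = ⊤) ∧
  a ≠ b ∧ a ≠ c ∧ b ≠ c ∧ a ≠ ⊥ ∧ b ≠ ⊥ ∧ c ≠ ⊥ ∧ a ≠ ⊤ ∧ b ≠ ⊤ ∧ c ≠ ⊤ ∧
  (⊥ : M) ≠ ⊤ ∧
  a ⊓ b = ⊥ ∧ a ⊓ c = ⊥ ∧ b ⊓ c = ⊥ ∧ a ⊔ b = ⊤ ∧ a ⊔ c = ⊤ ∧ b ⊔ c = ⊤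

/-- The smallest bi-ideal containing `s`. -/
def biIdealSpan {α β : Type*} [Lattice α] [OrderBot α] [Lattice β] [OrderBot β]
    (s : Set (α × β)) : Set (α × β) :=
  ⋂₀ {J : Set (α × β) | IsBiIdeal J ∧ s ⊆ J}

section BiIdeal

variable {α β : Type*} [Lattice α] [OrderBot α] [Lattice β] [OrderBot β]

lemma subset_biIdealSpan (s : Set (α × β)) : s ⊆ biIdealSpan s :=
  Set.subset_sInter fun _ hJ => hJ.2

lemma biIdealSpan_subset {s J : Set (α × β)} (hJ : IsBiIdeal J) (hs : s ⊆ J) :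
    biIdealSpan s ⊆ J :=
  Set.sInter_subset_of_mem ⟨hJ, hs⟩

lemma isBiIdeal_biIdealSpan (s : Set (α × β)) : IsBiIdeal (biIdealSpan s) := by
  refine ⟨isLowerSet_sInter fun J hJ => hJ.1.1, Set.subset_sInter fun J hJ => hJ.1.2.1, ?_, ?_⟩
  · exact fun a₀ a₁ b h₀ h₁ J hJ => hJ.1.2.2.1 _ _ _ (h₀ J hJ) (h₁ J hJ)
  · exact fun a b₀ b₁ h₀ h₁ J hJ => hJ.1.2.2.2 _ _ _ (h₀ J hJ) (h₁ J hJ)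

/-- The element of the tensor product generated by a finite set. -/
def TensorProd.span (s : Finset (α × β)) : TensorProd α β := ⟨biIdealSpan s, s, rfl⟩

lemma InTensor.isBiIdeal {I : Set (α × β)} (hI : InTensor I) : IsBiIdeal I := by
  obtain ⟨s, rfl⟩ := hI
  exact isBiIdeal_biIdealSpan _

lemma TensorProd.span_le {s : Finset (α × β)} {I : TensorProd α β} (h : ↑s ⊆ I.1) :
    TensorProd.span s ≤ I :=
  biIdealSpan_subset I.2.isBiIdeal h

/-- Greatest lower bounds in the tensor product are intersections. -/
lemma TensorProd.mem_of_isGLB {I J K : TensorProd α β} (hK : IsGLB {I, J} K) {p : α × β}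
    (hI : p ∈ I.1) (hJ : p ∈ J.1) : p ∈ K.1 := by
  have h : TensorProd.span {p} ≤ K := by
    refine hK.2 ?_
    rintro L (rfl | rfl)
    · exact TensorProd.span_le (by simpa using hI)
    · exact TensorProd.span_le (by simpa using hJ)
  exact h (subset_biIdealSpan _ (by simp))

/-- The bi-ideal `a ⊗ w`. -/
def pureTensor (a : α) (w : β) : Set (α × β) := {p | p.1 = ⊥ ∨ p.2 = ⊥ ∨ p.1 ≤ a ∧ p.2 ≤ w}

lemma isBiIdeal_pureTensor (a : α) (w : β) : IsBiIdeal (pureTensor a w) := by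
  refine ⟨?_, ?_, ?_, ?_⟩
  · rintro ⟨p, q⟩ ⟨p', q'⟩ ⟨hp, hq⟩ (h | h | ⟨h₁, h₂⟩)
    · exact Or.inl (le_bot_iff.1 (hp.trans h.le))
    · exact Or.inr (Or.inl (le_bot_iff.1 (hq.trans h.le)))
    · exact Or.inr (Or.inr ⟨hp.trans h₁, hq.trans h₂⟩)
  · rintro ⟨p, q⟩ (h | h)
    · exact Or.inl h
    · exact Or.inr (Or.inl h)
  · rintro p p' q (h | h | ⟨h₁, h₂⟩) (h' | h' | ⟨h₁', h₂'⟩) <;>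
      simp_all [pureTensor]
  · rintro p q q' (h | h | ⟨h₁, h₂⟩) (h' | h' | ⟨h₁', h₂'⟩) <;>
      simp_all [pureTensor]

end BiIdeal

section M3

variable {M : Type*} [Lattice M] [BoundedOrder M] {a b c : M}

lemma IsM3.swap (h : IsM3 M a b c) : IsM3 M b a c := by
  obtain ⟨h0, h1, h2, h3, h4, h5, h6, h7, h8, h9, h10, h11, h12, h13, h14, h15, h16⟩ := h
  refine ⟨fun x => ?_, h1.symm, h3, h2, h5, h4, h6, h8, h7, h9, h10, inf_comm a b ▸ h11, h13, h12,
    sup_comm a b ▸ h14, h16, h15⟩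
  have := h0 x
  tauto

lemma IsM3.rotate (h : IsM3 M a b c) : IsM3 M c a b := by
  obtain ⟨h0, h1, h2, h3, h4, h5, h6, h7, h8, h9, h10, h11, h12, h13, h14, h15, h16⟩ := h
  refine ⟨fun x => ?_, h2.symm, h3.symm, h1, h6, h4, h5, h9, h7, h8, h10, inf_comm a c ▸ h12,
    inf_comm b c ▸ h13, h11, sup_comm a c ▸ h15, sup_comm b c ▸ h16, h14⟩
  have := h0 x
  tauto

lemma IsM3.eq_bot_or_le (h : IsM3 M a b c) {p : M} (hp : p ≤ a) : p = ⊥ ∨ a ≤ p := by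
  obtain ⟨h0, -, -, -, -, -, -, -, -, -, -, h11, h12, -⟩ := h
  rcases h0 p with rfl | rfl | rfl | rfl | rfl
  · exact Or.inl rfl
  · exact Or.inr le_rfl
  · exact Or.inl (by rwa [inf_eq_right.2 hp] at h11)
  · exact Or.inl (by rwa [inf_eq_right.2 hp] at h12)
  · exact Or.inr le_top

lemma IsM3.not_le (h : IsM3 M a b c) : ¬ a ≤ b := by
  obtain ⟨-, -, -, -, h4, -, -, -, -, -, -, h11, -⟩ := h
  exact fun hab => h4 (by rwa [inf_eq_left.2 hab] at h11)

lemma IsM3.le_sup (h : IsM3 M a b c) {p q : M} (hpq : a ≤ p ⊔ q) :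
    a ≤ p ∨ a ≤ q ∨ (b ≤ p ∧ c ≤ q) ∨ (c ≤ p ∧ b ≤ q) := by
  have h0 := h.1
  rcases h0 p with rfl | rfl | rfl | rfl | rfl <;> rcases h0 q with rfl | rfl | rfl | rfl | rfl <;>
    simp_all

/-- A balanced triple of ideals determines a bi-ideal. -/
lemma IsM3.isBiIdeal_of_balanced {β : Type*} [Lattice β] [OrderBot β] (h : IsM3 M a b c)
    (A B C : Order.Ideal β) (hA : ∀ q, q ∈ B → q ∈ C → q ∈ A) (hB : ∀ q, q ∈ A → q ∈ C → q ∈ B)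
    (hC : ∀ q, q ∈ A → q ∈ B → q ∈ C) :
    IsBiIdeal {p : M × β | (a ≤ p.1 → p.2 ∈ A) ∧ (b ≤ p.1 → p.2 ∈ B) ∧ (c ≤ p.1 → p.2 ∈ C)} := by
  have ha0 := h.2.2.2.2.1
  have hb0 := h.2.2.2.2.2.1
  have hc0 := h.2.2.2.2.2.2.1
  refine ⟨?_, ?_, ?_, ?_⟩
  · rintro ⟨p, q⟩ ⟨p', q'⟩ ⟨hp, hq⟩ ⟨h₁, h₂, h₃⟩
    exact ⟨fun hx => A.lower hq (h₁ (hx.trans hp)), fun hx => B.lower hq (h₂ (hx.trans hp)),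
      fun hx => C.lower hq (h₃ (hx.trans hp))⟩
  · rintro ⟨p, q⟩ (hp | hq)
    · obtain rfl : p = ⊥ := hp
      simp [ha0, hb0, hc0]
    · obtain rfl : q = ⊥ := hq
      simp
  · rintro p p' q ⟨h₁, h₂, h₃⟩ ⟨h₁', h₂', h₃'⟩
    refine ⟨fun hx => ?_, fun hx => ?_, fun hx => ?_⟩
    · rcases h.le_sup hx with k | k | ⟨k, k'⟩ | ⟨k, k'⟩
      · exact h₁ k
      · exact h₁' k
      · exact hA _ (h₂ k) (h₃' k')
      · exact hA _ (h₂' k') (h₃ k)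
    · rcases h.swap.le_sup hx with k | k | ⟨k, k'⟩ | ⟨k, k'⟩
      · exact h₂ k
      · exact h₂' k
      · exact hB _ (h₁ k) (h₃' k')
      · exact hB _ (h₁' k') (h₃ k)
    · rcases h.rotate.le_sup hx with k | k | ⟨k, k'⟩ | ⟨k, k'⟩
      · exact h₃ k
      · exact h₃' k
      · exact hC _ (h₁ k) (h₂' k')
      · exact hC _ (h₁' k') (h₂ k)
  · rintro p q q' ⟨h₁, h₂, h₃⟩ ⟨h₁', h₂', h₃'⟩
    exact ⟨fun hx => Order.Ideal.sup_mem (h₁ hx) (h₁' hx),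
      fun hx => Order.Ideal.sup_mem (h₂ hx) (h₂' hx),
      fun hx => Order.Ideal.sup_mem (h₃ hx) (h₃' hx)⟩

end M3

/-- The ideal generated by a monotone sequence. -/
def seqIdeal {β : Type*} [Lattice β] (f : ℕ → β) (hf : Monotone f) : Order.Ideal β where
  carrier := {q | ∃ n, q ≤ f n}
  lower' _ _ h := fun ⟨n, hn⟩ => ⟨n, h.trans hn⟩
  nonempty' := ⟨f 0, 0, le_rfl⟩
  directed' := by
    rintro p ⟨m, hm⟩ q ⟨n, hn⟩
    exact ⟨f (max m n), ⟨_, le_rfl⟩, hm.trans (hf (le_max_left m n)),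
      hn.trans (hf (le_max_right m n))⟩

/-- Points of the closure space underlying the counterexample. -/
inductive ZigzagPoint : Type
  | x : ZigzagPoint
  | y : ZigzagPoint
  | r : ℕ → ZigzagPoint

/-- In the presence of `x`, each `r (2k)` forces `r (2k+1)`; in the presence of `y`, each
`r (2k+1)` forces `r (2k+2)`. -/
def IsZigzagClosed (S : Set ZigzagPoint) : Prop :=
  (.x ∈ S → ∀ k, .r (2 * k) ∈ S → .r (2 * k + 1) ∈ S) ∧
  (.y ∈ S → ∀ k, .r (2 * k + 1) ∈ S → .r (2 * k + 2) ∈ S)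

/-- The lattice of closed sets of the zigzag closure space. -/
abbrev Zigzag : Type := {S : Set ZigzagPoint // IsZigzagClosed S}

namespace Zigzag

instance : InfSet Zigzag where
  sInf F := ⟨{p | ∀ S ∈ F, p ∈ S.1},
    fun h k hk S hS => S.2.1 (h S hS) k (hk S hS),
    fun h k hk S hS => S.2.2 (h S hS) k (hk S hS)⟩

noncomputable instance : CompleteLattice Zigzag :=
  completeLatticeOfInf Zigzag fun _ =>
    ⟨fun _ hS _ hp => hp _ hS, fun _ hT _ hp _ hS => hT hS hp⟩

/-- The closed set `{r 0, …, r (n - 1)}`. -/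
def rung (n : ℕ) : Zigzag := ⟨{p | ∃ k < n, p = .r k}, by simp [IsZigzagClosed]⟩

/-- The closed set of all `r n`. -/
def rail : Zigzag := ⟨{p | ∃ k, p = .r k}, by simp [IsZigzagClosed]⟩

/-- The closed set `{x, r 0, …, r (2n - 1)}`. -/
def left (n : ℕ) : Zigzag :=
  ⟨{p | p = .x ∨ ∃ k < 2 * n, p = .r k}, by simp [IsZigzagClosed]; omega⟩

/-- The closed set `{y, r 0, …, r (2n)}`. -/
def right (n : ℕ) : Zigzag :=
  ⟨{p | p = .y ∨ ∃ k < 2 * n + 1, p = .r k}, by simp [IsZigzagClosed]; omega⟩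

lemma rung_le_rail (n : ℕ) : rung n ≤ rail := fun _ ⟨k, _, h⟩ => ⟨k, h⟩

lemma rung_le_left (n : ℕ) : rung (2 * n) ≤ left n := fun _ h => Or.inr h

lemma rung_le_right (n : ℕ) : rung (2 * n + 1) ≤ right n := fun _ h => Or.inr h

lemma left_mono : Monotone left := by
  rintro m n h p (hp | ⟨k, hk, hp⟩)
  · exact Or.inl hp
  · exact Or.inr ⟨k, by omega, hp⟩

lemma right_mono : Monotone right := by
  rintro m n h p (hp | ⟨k, hk, hp⟩)
  · exact Or.inl hp
  · exact Or.inr ⟨k, by omega, hp⟩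

lemma not_left_succ_le (n : ℕ) : ¬ left (n + 1) ≤ left n := by
  intro h
  have : ZigzagPoint.r (2 * n) ∈ (left n).1 := h (Or.inr ⟨2 * n, by omega, rfl⟩)
  simp [left] at this

lemma left_succ_le (n : ℕ) : left (n + 1) ≤ left n ⊔ rung (2 * n + 1) := by
  set W := left n ⊔ rung (2 * n + 1)
  have hl : left n ≤ W := le_sup_left
  have hr : rung (2 * n + 1) ≤ W := le_sup_right
  have hx : ZigzagPoint.x ∈ W.1 := hl (Or.inl rfl)
  rintro p (rfl | ⟨k, hk, rfl⟩)
  · exact hx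
  · rcases (by omega : k < 2 * n + 1 ∨ k = 2 * n + 1) with h | rfl
    · exact hr ⟨k, h, rfl⟩
    · exact W.2.1 hx n (hr ⟨_, by omega, rfl⟩)

lemma right_succ_le (n : ℕ) : right (n + 1) ≤ right n ⊔ rung (2 * (n + 1)) := by
  set W := right n ⊔ rung (2 * (n + 1))
  have hl : right n ≤ W := le_sup_left
  have hr : rung (2 * (n + 1)) ≤ W := le_sup_right
  have hy : ZigzagPoint.y ∈ W.1 := hl (Or.inl rfl)
  rintro p (rfl | ⟨k, hk, rfl⟩)
  · exact hy
  · rcases (by omega : k < 2 * (n + 1) ∨ k = 2 * n + 2) with h | rfl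
    · exact hr ⟨k, h, rfl⟩
    · exact W.2.2 hy n (hr ⟨_, by omega, rfl⟩)

lemma le_rung_of_le_rail {q : Zigzag} {n : ℕ} (h : ∀ k, .r k ∈ q.1 → k < n) (hq : q ≤ rail) :
    q ≤ rung n := by
  intro p hp
  obtain ⟨k, rfl⟩ := hq hp
  exact ⟨k, h k hp, rfl⟩

lemma balanced_left {q : Zigzag} (hr : q ∈ seqIdeal right right_mono)
    (hz : q ∈ Order.Ideal.principal rail) : q ∈ seqIdeal left left_mono := by
  obtain ⟨n, hn⟩ := hr
  refine ⟨n + 1, (le_rung_of_le_rail (fun k hk => ?_) hz).trans (rung_le_left (n + 1))⟩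
  have : ZigzagPoint.r k ∈ (right n).1 := hn hk
  simp [right] at this
  omega

lemma balanced_right {q : Zigzag} (hl : q ∈ seqIdeal left left_mono)
    (hz : q ∈ Order.Ideal.principal rail) : q ∈ seqIdeal right right_mono := by
  obtain ⟨n, hn⟩ := hl
  refine ⟨n, (le_rung_of_le_rail (fun k hk => ?_) hz).trans (rung_le_right n)⟩
  have : ZigzagPoint.r k ∈ (left n).1 := hn hk
  simp [left] at this
  omega

lemma balanced_rail {q : Zigzag} (hl : q ∈ seqIdeal left left_mono)
    (hr : q ∈ seqIdeal right right_mono) : q ∈ Order.Ideal.principal rail := by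
  obtain ⟨m, hm⟩ := hl
  obtain ⟨n, hn⟩ := hr
  intro p hp
  rcases hm hp with rfl | ⟨k, -, rfl⟩
  · have : ZigzagPoint.x ∈ (right n).1 := hn hp
    simp [right] at this
  · exact ⟨k, rfl⟩

/-- A bi-ideal containing `(a, x)`, `(b, y ∨ r 0)` and `(c, rail)` contains the whole zigzag. -/
lemma mem_of_isBiIdeal {M : Type*} [Lattice M] [BoundedOrder M] {a b c : M} (hM : IsM3 M a b c)
    {I : Set (M × Zigzag)} (hI : IsBiIdeal I) (ha : (a, left 0) ∈ I) (hb : (b, right 0) ∈ I)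
    (hc : (c, rail) ∈ I) (n : ℕ) : (a, left n) ∈ I ∧ (b, right n) ∈ I := by
  have hlow {p p' : M} {q q' : Zigzag} (hp : p' ≤ p) (hq : q' ≤ q) (h : (p, q) ∈ I) :
      (p', q') ∈ I := hI.1 (Prod.mk_le_mk.2 ⟨hp, hq⟩) h
  obtain ⟨-, -, hfst, hsnd⟩ := hI
  have hac : a ⊔ c = ⊤ := hM.2.2.2.2.2.2.2.2.2.2.2.2.2.2.2.1
  have hbc : b ⊔ c = ⊤ := hM.2.2.2.2.2.2.2.2.2.2.2.2.2.2.2.2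
  have hrung (m : ℕ) : (c, rung m) ∈ I := hlow le_rfl (rung_le_rail m) hc
  induction n with
  | zero => exact ⟨ha, hb⟩
  | succ n ih =>
    have hl : (a, left (n + 1)) ∈ I := by
      have h₁ : (b, rung (2 * n + 1)) ∈ I := hlow le_rfl (rung_le_right n) ih.2
      have h₂ := hfst _ _ _ h₁ (hrung _)
      rw [hbc] at h₂
      exact hlow le_rfl (left_succ_le n) (hsnd _ _ _ ih.1 (hlow le_top le_rfl h₂))
    refine ⟨hl, ?_⟩
    have h₁ : (a, rung (2 * (n + 1))) ∈ I := hlow le_rfl (rung_le_left (n + 1)) hl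
    have h₂ := hfst _ _ _ h₁ (hrung _)
    rw [hac] at h₂
    exact hlow le_rfl (right_succ_le n) (hsnd _ _ _ ih.2 (hlow le_top le_rfl h₂))

end Zigzag

/-- There is a bounded lattice `L` such that the tensor product `M₃ ⊗ L` is not a lattice
(negative solution to Quackenbush's problem). -/
theorem stmt12 {M : Type*} [Lattice M] [BoundedOrder M] {a b c : M}
    (hM : IsM3 M a b c) :
    ∃ (α : Type) (_ : Lattice α) (_ : BoundedOrder α),
      ¬ ((∀ I J : TensorProd M α, ∃ K, IsLUB {I, J} K) ∧
         (∀ I J : TensorProd M α, ∃ K, IsGLB {I, J} K)) := by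
  classical
  refine ⟨Zigzag, inferInstance, inferInstance, fun ⟨_, hglb⟩ => ?_⟩
  let s : Finset (M × Zigzag) := {(a, Zigzag.left 0), (b, Zigzag.right 0), (c, Zigzag.rail)}
  obtain ⟨K, hK⟩ := hglb (TensorProd.span s) (TensorProd.span {(a, ⊤)})
  have hleft (n : ℕ) : (a, Zigzag.left n) ∈ K.1 := by
    refine TensorProd.mem_of_isGLB hK ?_ ?_
    · have hs := subset_biIdealSpan (s : Set (M × Zigzag))
      exact (Zigzag.mem_of_isBiIdeal hM (isBiIdeal_biIdealSpan _) (hs (by simp [s]))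
        (hs (by simp [s])) (hs (by simp [s])) n).1
    · exact (isBiIdeal_biIdealSpan _).1 (show (a, Zigzag.left n) ≤ (a, ⊤) from ⟨le_rfl, le_top⟩)
        (subset_biIdealSpan _ (by simp))
  have hab := hM.not_le
  have hba := hM.swap.not_le
  have hac := hM.rotate.swap.not_le
  have hca := hM.rotate.not_le
  have hbc := hM.swap.rotate.swap.not_le
  have hcb := hM.swap.rotate.not_le
  have hbound : ∀ p ∈ K.1, ∃ n, p ∈ pureTensor a (Zigzag.left n) := by
    rintro ⟨p, q⟩ hpq
    have h₁ := biIdealSpan_subset (hM.isBiIdeal_of_balanced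
      (seqIdeal _ Zigzag.left_mono) (seqIdeal _ Zigzag.right_mono)
      (Order.Ideal.principal Zigzag.rail) (fun _ => Zigzag.balanced_left)
      (fun _ => Zigzag.balanced_right) (fun _ => Zigzag.balanced_rail)) (s := s) (by
        rintro ⟨p, q⟩ h
        simp only [s, Finset.coe_insert, Finset.coe_singleton, Set.mem_insert_iff,
          Set.mem_singleton_iff, Prod.mk.injEq] at h
        rcases h with ⟨rfl, rfl⟩ | ⟨rfl, rfl⟩ | ⟨rfl, rfl⟩
        · exact ⟨fun _ => ⟨0, le_rfl⟩, fun h => absurd h hba, fun h => absurd h hca⟩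
        · exact ⟨fun h => absurd h hab, fun _ => ⟨0, le_rfl⟩, fun h => absurd h hcb⟩
        · exact ⟨fun h => absurd h hac, fun h => absurd h hbc, fun _ => le_refl Zigzag.rail⟩)
      (hK.1 (Set.mem_insert _ _) hpq)
    have h₂ := biIdealSpan_subset (isBiIdeal_pureTensor a ⊤) (by simp [pureTensor])
      (hK.1 (Set.mem_insert_of_mem _ rfl) hpq)
    rcases h₂ with h | h | ⟨h, -⟩
    · exact ⟨0, Or.inl h⟩
    · exact ⟨0, Or.inr (Or.inl h)⟩
    · rcases hM.eq_bot_or_le h with h' | h'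
      · exact ⟨0, Or.inl h'⟩
      · obtain ⟨n, hn⟩ := h₁.1 h'
        exact ⟨n, Or.inr (Or.inr ⟨h, hn⟩)⟩
  obtain ⟨t, ht⟩ : ∃ t : Finset (M × Zigzag), K.1 = biIdealSpan t := K.2
  have htK : (t : Set (M × Zigzag)) ⊆ K.1 := ht ▸ subset_biIdealSpan _
  choose! f hf using hbound
  have hsub : K.1 ⊆ pureTensor a (Zigzag.left (t.sup f)) := by
    rw [ht]
    refine biIdealSpan_subset (isBiIdeal_pureTensor _ _) fun p hp => ?_
    rcases hf p (htK hp) with h | h | ⟨h, h'⟩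
    · exact Or.inl h
    · exact Or.inr (Or.inl h)
    · exact Or.inr (Or.inr ⟨h, h'.trans (Zigzag.left_mono (Finset.le_sup hp))⟩)
  rcases hsub (hleft (t.sup f + 1)) with h | h | ⟨-, h⟩
  · exact hM.2.2.2.2.1 h
  · exact Zigzag.not_left_succ_le _ (le_of_eq_of_le h bot_le)
  · exact Zigzag.not_left_succ_le _ h
end
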